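/- Assume (H0), (H1) and (H2) hold for V with parameters D, C, s, let δ_n = n^{−α} with 0 < α ≤ 1, and let a be a variation sequence of length L and order M with M > D + s + 1/4; set n' = n − L + 1 and Σ_n(i,i') = −Σ_j (a^{2*})_j V((i−i'+j)δ_n) for 1 ≤ i, i' ≤ n'. Then max_{1≤i≤n'} Σ_{i'=1}^{n'} |Σ_n(i,i')| = o( ( 2 Σ_{i=1}^{n'} Σ_{i'=1}^{n'} Σ_n(i,i')² )^{1/2} ) as n → ∞; that is, the maximal absolute row sum of Σ_n is negligible compared with the standard deviation Var(V_{a,n})^{1/2} of the quadratic a-variation. -/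

import Mathlib

open Filter MeasureTheory

/-- Convolution of finitely supported sequences: `(a*a')_m = Σ_{k-l=m} a_k a'_l`. -/
noncomputable def seqConv (a a' : ℤ → ℝ) (m : ℤ) : ℝ := ∑ᶠ k : ℤ, a k * a' (k - m)

/-- The covariance matrix entry `Σ_n(i,i') = −Σ_j (a^{2*})_j V((i−i'+j)δ_n)`,
with `δ_n = n^{−α}`. -/
noncomputable def covEnt (a : ℤ → ℝ) (V : ℝ → ℝ) (α : ℝ) (L n : ℕ)
    (i i' : Fin (n - L + 1)) : ℝ :=
  -∑ᶠ j : ℤ, seqConv a a j * V (((i : ℤ) - (i' : ℤ) + j) * (n : ℝ) ^ (-α))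

lemma seqConv_eq_sum {a : ℤ → ℝ} {N : ℕ} (ha : ∀ j : ℤ, a j ≠ 0 → 0 ≤ j ∧ j ≤ N) (m : ℤ) :
    seqConv a a m = ∑ k ∈ Finset.Icc (0 : ℤ) N, a k * a (k - m) := by
  refine finsum_eq_sum_of_support_subset _ fun k hk => ?_
  have := ha k (left_ne_zero_of_mul hk)
  simpa using this

lemma seqConv_ne_zero {a : ℤ → ℝ} {N : ℕ} (ha : ∀ j : ℤ, a j ≠ 0 → 0 ≤ j ∧ j ≤ N) {m : ℤ}
    (hm : seqConv a a m ≠ 0) : m ∈ Finset.Icc (-(N : ℤ)) N := by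
  rw [seqConv_eq_sum ha] at hm
  obtain ⟨k, -, hk⟩ := Finset.exists_ne_zero_of_sum_ne_zero hm
  have h1 := ha k (left_ne_zero_of_mul hk)
  have h2 := ha _ (right_ne_zero_of_mul hk)
  rw [Finset.mem_Icc]
  omega

lemma seqConv_neg (a : ℤ → ℝ) (m : ℤ) : seqConv a a (-m) = seqConv a a m := by
  unfold seqConv
  rw [← finsum_comp_equiv (Equiv.subRight m)]
  refine finsum_congr fun k => ?_
  simp [mul_comm]

lemma seqConv_neg_endpoint {a : ℤ → ℝ} {N : ℕ} (ha : ∀ j : ℤ, a j ≠ 0 → 0 ≤ j ∧ j ≤ N) :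
    seqConv a a (-N) = a 0 * a N := by
  rw [seqConv_eq_sum ha, Finset.sum_eq_single 0]
  · simp
  · intro k hk hk0
    rw [Finset.mem_Icc] at hk
    have : a (k - -N) = 0 := by
      by_contra h
      have := ha _ h
      omega
    rw [this, mul_zero]
  · simp

lemma sum_seqConv_mul {a : ℤ → ℝ} {N : ℕ} (ha : ∀ j : ℤ, a j ≠ 0 → 0 ≤ j ∧ j ≤ N) (g : ℤ → ℝ) :
    ∑ m ∈ Finset.Icc (-(N : ℤ)) N, seqConv a a m * g m =
      ∑ k ∈ Finset.Icc (0 : ℤ) N, ∑ l ∈ Finset.Icc (0 : ℤ) N, a k * a l * g (k - l) := by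
  simp_rw [seqConv_eq_sum ha, Finset.sum_mul]
  rw [Finset.sum_comm]
  refine Finset.sum_congr rfl fun k hk => ?_
  rw [Finset.mem_Icc] at hk
  symm
  refine Finset.sum_of_injOn (fun l => k - l) (fun x _ y _ h => by simpa using h) ?_ ?_ ?_
  · intro l hl
    simp only [Finset.coe_Icc, Set.mem_Icc] at hl ⊢
    omega
  · intro m _ hm
    have : a (k - m) = 0 := by
      by_contra h
      refine hm ⟨k - m, ?_, by simp⟩
      simpa using ha _ h
    simp [this]
  · intro l _
    simp

lemma sum_seqConv_mul_pow {a : ℤ → ℝ} {N M : ℕ} (ha : ∀ j : ℤ, a j ≠ 0 → 0 ≤ j ∧ j ≤ N)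
    (hmom : ∀ k : ℕ, k < M → ∑ᶠ j : ℤ, a j * (j : ℝ) ^ k = 0) {q : ℕ} (hq : q < 2 * M) :
    ∑ m ∈ Finset.Icc (-(N : ℤ)) N, seqConv a a m * (m : ℝ) ^ q = 0 := by
  have hfin : ∀ k < M, ∑ j ∈ Finset.Icc (0 : ℤ) N, a j * (j : ℝ) ^ k = 0 := by
    intro k hk
    rw [← hmom k hk]
    symm
    refine finsum_eq_sum_of_support_subset _ fun j hj => ?_
    simpa using ha j (left_ne_zero_of_mul hj)
  rw [sum_seqConv_mul ha fun m => (m : ℝ) ^ q]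
  have hexp : ∀ k l : ℤ, a k * a l * ((k - l : ℤ) : ℝ) ^ q =
      ∑ i ∈ Finset.range (q + 1),
        ((q.choose i : ℝ) * (-1) ^ (q - i)) * ((a k * (k : ℝ) ^ i) * (a l * (l : ℝ) ^ (q - i))) := by
    intro k l
    push_cast
    rw [sub_eq_add_neg, add_pow, Finset.mul_sum]
    refine Finset.sum_congr rfl fun i _ => ?_
    rw [neg_pow]
    ring
  simp_rw [hexp]
  have hswap : ∀ k ∈ Finset.Icc (0 : ℤ) N, (∑ l ∈ Finset.Icc (0 : ℤ) N,
      ∑ i ∈ Finset.range (q + 1), ((q.choose i : ℝ) * (-1) ^ (q - i)) *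
        ((a k * (k : ℝ) ^ i) * (a l * (l : ℝ) ^ (q - i)))) =
      ∑ i ∈ Finset.range (q + 1), ((q.choose i : ℝ) * (-1) ^ (q - i)) *
        ((a k * (k : ℝ) ^ i) * ∑ l ∈ Finset.Icc (0 : ℤ) N, a l * (l : ℝ) ^ (q - i)) := by
    intro k _
    rw [Finset.sum_comm]
    simp_rw [Finset.mul_sum]
  rw [Finset.sum_congr rfl hswap, Finset.sum_comm]
  refine Finset.sum_eq_zero fun i hi => ?_
  rw [← Finset.mul_sum, ← Finset.sum_mul]
  rw [Finset.mem_range] at hi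
  rcases lt_or_ge i M with h | h
  · rw [hfin i h]
    simp
  · rw [hfin (q - i) (by omega)]
    simp

/-- A sequence annihilating the powers of degree less than `Q` annihilates the polynomials of
degree less than `Q`. -/
lemma sum_mul_sum_pow_eq_zero {S : Finset ℤ} {b : ℤ → ℝ} {Q : ℕ}
    (hb : ∀ q < Q, ∑ j ∈ S, b j * (j : ℝ) ^ q = 0) (P : Polynomial ℝ) (hP : P.natDegree < Q) :
    ∑ j ∈ S, b j * P.eval (j : ℝ) = 0 := by
  simp_rw [Polynomial.eval_eq_sum_range' hP, Finset.mul_sum]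
  rw [Finset.sum_comm]
  refine Finset.sum_eq_zero fun i hi => ?_
  rw [← mul_zero (P.coeff i), ← hb i (Finset.mem_range.1 hi), Finset.mul_sum]
  exact Finset.sum_congr rfl fun j _ => by ring

lemma sum_mul_affine_pow_eq_zero {S : Finset ℤ} {b : ℤ → ℝ} {Q : ℕ}
    (hb : ∀ q < Q, ∑ j ∈ S, b j * (j : ℝ) ^ q = 0) {q : ℕ} (hq : q < Q) (u v : ℝ) :
    ∑ j ∈ S, b j * (u + v * j) ^ q = 0 := by
  have hdeg : ((Polynomial.C u + Polynomial.C v * Polynomial.X) ^ q).natDegree < Q := by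
    refine lt_of_le_of_lt ?_ hq
    refine Polynomial.natDegree_pow_le_of_le q (m := 1) ?_ |>.trans (by simp)
    compute_degree
  simpa using sum_mul_sum_pow_eq_zero hb _ hdeg

lemma eq_zero_of_forall_sum_mul_pow_eq_zero {S : Finset ℤ} {b : ℤ → ℝ}
    (hb : ∀ q : ℕ, ∑ j ∈ S, b j * (j : ℝ) ^ q = 0) {i : ℤ} (hi : i ∈ S) : b i = 0 := by
  have h := sum_mul_sum_pow_eq_zero (fun q _ => hb q)
    (∏ k ∈ S.erase i, (Polynomial.X - Polynomial.C (k : ℝ))) (Nat.lt_succ_self _)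
  simp only [Polynomial.eval_prod, Polynomial.eval_sub, Polynomial.eval_X, Polynomial.eval_C] at h
  rw [Finset.sum_eq_single i] at h
  · refine (mul_eq_zero.1 h).resolve_right (Finset.prod_ne_zero_iff.2 fun k hk => ?_)
    rw [sub_ne_zero]
    exact_mod_cast (Finset.ne_of_mem_erase hk).symm
  · intro j hj hji
    exact mul_eq_zero_of_right _ (Finset.prod_eq_zero (Finset.mem_erase.2 ⟨hji, hj⟩) (sub_self _))
  · exact fun h => absurd hi h

/-- If `∑ b_j (1 + j t) ^ p` vanishes near `t = 0` and `p` is not a natural number, then all the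
moments of `b` vanish. -/
lemma moments_eq_zero_of_eventually {S : Finset ℤ} {b : ℤ → ℝ} {p : ℝ} (hp : ∀ k : ℕ, p ≠ k)
    (h : ∀ᶠ t in nhds (0 : ℝ), ∑ j ∈ S, b j * (1 + j * t) ^ p = 0) (q : ℕ) :
    ∑ j ∈ S, b j * (j : ℝ) ^ q = 0 := by
  have key : ∀ᶠ t in nhds (0 : ℝ), ∑ j ∈ S, b j * (j : ℝ) ^ q * (1 + j * t) ^ (p - q) = 0 := by
    induction q with
    | zero => simpa using h
    | succ q ih =>
      have hpos : ∀ᶠ t in nhds (0 : ℝ), ∀ j ∈ S, (1 + (j : ℝ) * t) ≠ 0 := by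
        rw [Filter.eventually_all_finset]
        intro j _
        have : ContinuousAt (fun t : ℝ => 1 + (j : ℝ) * t) 0 := by fun_prop
        exact this.eventually_ne (by simp)
      filter_upwards [ih.eventually_nhds, hpos] with t ht htp
      have hd : HasDerivAt (fun t : ℝ => ∑ j ∈ S, b j * (j : ℝ) ^ q * (1 + j * t) ^ (p - q))
          (∑ j ∈ S, b j * (j : ℝ) ^ q * (j * (p - q) * (1 + j * t) ^ (p - q - 1))) t := by
        refine HasDerivAt.fun_sum fun j hj => HasDerivAt.const_mul _ ?_
        refine HasDerivAt.rpow_const ?_ (Or.inl (htp j hj))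
        simpa using ((hasDerivAt_id t).const_mul (j : ℝ)).const_add 1
      have h0 : HasDerivAt (fun t : ℝ => ∑ j ∈ S, b j * (j : ℝ) ^ q * (1 + j * t) ^ (p - q)) 0 t :=
        (hasDerivAt_const t (0 : ℝ)).congr_of_eventuallyEq ht
      have h1 := hd.unique h0
      have h2 : (p - q) * ∑ j ∈ S, b j * (j : ℝ) ^ (q + 1) * (1 + j * t) ^ (p - (q + 1 : ℕ)) = 0 := by
        rw [← h1, Finset.mul_sum]
        refine Finset.sum_congr rfl fun j _ => ?_
        push_cast
        rw [sub_sub]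
        ring
      exact (mul_eq_zero.1 h2).resolve_left (sub_ne_zero.2 (hp q))
  simpa using key.self_of_nhds

lemma exists_sum_abs_rpow_ne_zero {N Q : ℕ} {b : ℤ → ℝ}
    (hb : ∀ q < Q, ∑ j ∈ Finset.Icc (-(N : ℤ)) N, b j * (j : ℝ) ^ q = 0) (hN : b (-N) ≠ 0)
    {p : ℝ} (hpQ : p < Q) (hp0 : 0 < p) (hp : ∀ k : ℕ, Even k → p ≠ k) :
    ∃ m : ℕ, ∑ j ∈ Finset.Icc (-(N : ℤ)) N, b j * |(m : ℝ) + j| ^ p ≠ 0 := by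
  by_cases hint : ∃ k : ℕ, p = k
  · obtain ⟨k, rfl⟩ := hint
    have hodd : Odd k := by
      rw [← Nat.not_even_iff_odd]
      exact fun h => hp k h rfl
    have hkQ : k < Q := by exact_mod_cast hpQ
    have hN0 : N ≠ 0 := by
      rintro rfl
      have := hb 0 (by omega)
      simp at this hN
      exact hN this
    refine ⟨N - 1, ?_⟩
    have hterm : ∀ j ∈ Finset.Icc (-(N : ℤ)) N, b j * |((N - 1 : ℕ) : ℝ) + j| ^ (k : ℝ) =
        b j * (((N - 1 : ℕ) : ℝ) + 1 * j) ^ k + if j = -N then 2 * b j else 0 := by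
      intro j hj
      rw [Finset.mem_Icc] at hj
      rw [Real.rpow_natCast, one_mul, Nat.cast_sub (by omega)]
      split_ifs with hjN
      · subst hjN
        have h1 : ((N : ℝ) - ((1 : ℕ) : ℝ) + ((-N : ℤ) : ℝ)) = -1 := by push_cast; ring
        rw [h1, hodd.neg_one_pow]
        simp
        ring
      · rw [abs_of_nonneg, add_zero]
        have : (0 : ℤ) ≤ N - 1 + j := by omega
        exact_mod_cast this
    rw [Finset.sum_congr rfl hterm, Finset.sum_add_distrib, sum_mul_affine_pow_eq_zero hb hkQ]
    simpa using hN
  · push Not at hint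
    by_contra! hzero
    have hana : AnalyticAt ℝ
        (fun t : ℝ => ∑ j ∈ Finset.Icc (-(N : ℤ)) N, b j * (1 + j * t) ^ p) 0 := by
      refine Finset.analyticAt_fun_sum _ fun j _ => analyticAt_const.mul ?_
      have h1 : AnalyticAt ℝ (fun t : ℝ => 1 + (j : ℝ) * t) 0 := by fun_prop
      have h2 : AnalyticAt ℝ (fun x : ℝ => x ^ p) (1 + (j : ℝ) * 0) := by
        have : ContDiffAt ℝ ⊤ (fun x : ℝ => x ^ p) (1 + (j : ℝ) * 0) :=
          Real.contDiffAt_rpow_const_of_ne (by simp)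
        exact this.analyticAt
      exact AnalyticAt.comp_of_eq h2 h1 rfl
    have hseq : Tendsto (fun n : ℕ => 1 / ((n : ℝ) + 1)) atTop (nhdsWithin 0 {0}ᶜ) := by
      refine tendsto_nhdsWithin_iff.2 ⟨tendsto_one_div_add_atTop_nhds_zero_nat,
        Eventually.of_forall fun n => ?_⟩
      exact (Nat.one_div_pos_of_nat).ne'
    have hev : ∀ᶠ n : ℕ in atTop, ∑ j ∈ Finset.Icc (-(N : ℤ)) N,
        b j * (1 + j * (1 / ((n : ℝ) + 1))) ^ p = 0 := by
      filter_upwards [eventually_ge_atTop N] with n hn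
      have h0 := hzero (n + 1)
      have hn1 : (0 : ℝ) < (n : ℝ) + 1 := by positivity
      have : ∀ j ∈ Finset.Icc (-(N : ℤ)) N, b j * |((n + 1 : ℕ) : ℝ) + j| ^ p =
          ((n : ℝ) + 1) ^ p * (b j * (1 + j * (1 / ((n : ℝ) + 1))) ^ p) := by
        intro j hj
        rw [Finset.mem_Icc] at hj
        have hj' : (-(N : ℝ)) ≤ j := by exact_mod_cast hj.1
        have hn' : (N : ℝ) ≤ n := by exact_mod_cast hn
        have hpos : 0 ≤ (n : ℝ) + 1 + j := by linarith
        have : (1 + j * (1 / ((n : ℝ) + 1))) = ((n : ℝ) + 1 + j) / ((n : ℝ) + 1) := by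
          field_simp
        rw [this, Real.div_rpow hpos hn1.le]
        push_cast
        rw [abs_of_nonneg hpos]
        have := (Real.rpow_pos_of_pos hn1 p).ne'
        field_simp
      rw [Finset.sum_congr rfl this, ← Finset.mul_sum] at h0
      exact (mul_eq_zero.1 h0).resolve_left (Real.rpow_pos_of_pos hn1 p).ne'
    have hall := hana.frequently_zero_iff_eventually_zero.1 (hseq.frequently hev.frequently)
    exact hN (eq_zero_of_forall_sum_mul_pow_eq_zero (moments_eq_zero_of_eventually hint hall)
      (by simp))

lemma isLittleO_rpow_of_deriv {g : ℝ → ℝ} {q : ℝ} (hq : 0 ≤ q) (hg : Differentiable ℝ g)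
    (h0 : g 0 = 0) (h : deriv g =o[nhdsWithin 0 (Set.Ioi 0)] fun x : ℝ => x ^ q) :
    g =o[nhdsWithin 0 (Set.Ioi 0)] fun x : ℝ => x ^ (q + 1) := by
  refine Asymptotics.isLittleO_iff.2 fun ε hε => ?_
  obtain ⟨η, hη, hη'⟩ := mem_nhdsGT_iff_exists_Ioo_subset.1 (Asymptotics.isLittleO_iff.1 h hε)
  filter_upwards [Ioo_mem_nhdsGT hη] with x hx
  obtain ⟨c, hc, hcx⟩ := exists_deriv_eq_slope g hx.1 hg.continuous.continuousOn
    hg.differentiableOn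
  have h1 : ‖deriv g c‖ ≤ ε * ‖c ^ q‖ := hη' ⟨hc.1, hc.2.trans hx.2⟩
  have hgx : g x = deriv g c * x := by
    rw [hcx, h0, sub_zero, sub_zero, div_mul_cancel₀ _ hx.1.ne']
  rw [hgx, norm_mul, Real.norm_of_nonneg hx.1.le,
    Real.norm_of_nonneg (Real.rpow_nonneg hx.1.le _), Real.rpow_add_one hx.1.ne', ← mul_assoc]
  refine mul_le_mul_of_nonneg_right (h1.trans ?_) hx.1.le
  rw [Real.norm_of_nonneg (Real.rpow_nonneg hc.1.le _)]
  exact mul_le_mul_of_nonneg_left (Real.rpow_le_rpow hc.1.le hc.2.le hq) hε.le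

/-- A one-sided expansion of the `k`-th derivative with a fractional power integrates to an
expansion of the function. -/
lemma exists_isLittleO_taylor_rpow {s : ℝ} (hs : 0 < s) (k : ℕ) : ∀ (f : ℝ → ℝ) (c : ℝ),
    ContDiff ℝ k f → c ≠ 0 →
    (fun x => iteratedDeriv k f x - iteratedDeriv k f 0 - c * x ^ s)
      =o[nhdsWithin 0 (Set.Ioi 0)] (fun x : ℝ => x ^ s) →
    ∃ κ : ℝ, κ ≠ 0 ∧
      (fun x => f x - ∑ i ∈ Finset.range (k + 1), iteratedDeriv i f 0 / (i.factorial : ℝ) * x ^ i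
        - κ * x ^ (s + k)) =o[nhdsWithin 0 (Set.Ioi 0)] (fun x : ℝ => x ^ (s + k)) := by
  induction k with
  | zero =>
    intro f c _ hc h
    exact ⟨c, hc, by simpa using h⟩
  | succ k ih =>
    intro f c hf hc h
    have hf' : ContDiff ℝ k (deriv f) := by
      have : ContDiff ℝ ((k : WithTop ℕ∞) + 1) f := by exact_mod_cast hf
      exact (contDiff_succ_iff_deriv.1 this).2.2
    have hfd : Differentiable ℝ f := hf.differentiable (by simp)
    rw [iteratedDeriv_succ'] at h
    obtain ⟨κ, hκ, hlo⟩ := ih (deriv f) c hf' hc h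
    have hsk : 0 < s + k + 1 := by positivity
    refine ⟨κ / (s + k + 1), div_ne_zero hκ hsk.ne', ?_⟩
    have hd : ∀ x : ℝ, HasDerivAt
        (fun x => f x - ∑ i ∈ Finset.range (k + 1 + 1), iteratedDeriv i f 0 / (i.factorial : ℝ) * x ^ i
          - κ / (s + k + 1) * x ^ (s + (k + 1 : ℕ)))
        (deriv f x - ∑ i ∈ Finset.range (k + 1), iteratedDeriv i (deriv f) 0 / (i.factorial : ℝ) * x ^ i
        - κ * x ^ (s + k)) x := by
      intro x
      have hpow := ((Real.hasDerivAt_rpow_const (x := x) (p := s + k + 1)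
        (Or.inr (by linarith [(Nat.cast_nonneg k : (0 : ℝ) ≤ k)]))).const_mul (κ / (s + k + 1)))
      have e1 : κ / (s + k + 1) * ((s + k + 1) * x ^ (s + k + 1 - 1)) = κ * x ^ (s + k) := by
        rw [add_sub_cancel_right]
        field_simp
      rw [e1] at hpow
      have hcast : s + ((k + 1 : ℕ) : ℝ) = s + k + 1 := by push_cast; ring
      rw [hcast]
      refine ((hfd x).hasDerivAt.sub ?_).sub hpow
      simp_rw [Finset.sum_range_succ' _ (k + 1)]
      have hsum : HasDerivAt (fun x : ℝ => ∑ i ∈ Finset.range (k + 1),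
          iteratedDeriv (i + 1) f 0 / ((i + 1).factorial : ℝ) * x ^ (i + 1))
          (∑ i ∈ Finset.range (k + 1), iteratedDeriv i (deriv f) 0 / (i.factorial : ℝ) * x ^ i) x := by
        refine HasDerivAt.fun_sum fun i _ => ?_
        have hpw := (hasDerivAt_pow (i + 1) x).const_mul
          (iteratedDeriv (i + 1) f 0 / ((i + 1).factorial : ℝ))
        have e2 : iteratedDeriv (i + 1) f 0 / ((i + 1).factorial : ℝ) *
            (((i + 1 : ℕ) : ℝ) * x ^ (i + 1 - 1)) =
            iteratedDeriv i (deriv f) 0 / (i.factorial : ℝ) * x ^ i := by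
          rw [iteratedDeriv_succ', Nat.factorial_succ, add_tsub_cancel_right]
          push_cast
          field_simp
        rwa [e2] at hpw
      simpa using hsum.add_const (f 0)
    have hcast : s + ((k + 1 : ℕ) : ℝ) = (s + k) + 1 := by push_cast; ring
    have hfin := isLittleO_rpow_of_deriv (q := s + k) (by positivity)
      (fun x => (hd x).differentiableAt) ?_ ?_
    · simpa only [hcast] using hfin
    · have : s + ((k + 1 : ℕ) : ℝ) ≠ 0 := by rw [hcast]; exact hsk.ne'
      simp only [Real.zero_rpow this]
      simp [Finset.sum_range_succ']
    · rw [funext fun x => (hd x).deriv]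
      exact hlo

lemma iteratedDeriv_zero_of_even_of_odd {f : ℝ → ℝ} (hf : ∀ h, f (-h) = f h) {i : ℕ} (hi : Odd i) :
    iteratedDeriv i f 0 = 0 := by
  have h := iteratedDeriv_comp_neg i f 0
  simp only [hf, hi.neg_one_pow, neg_zero, smul_eq_mul] at h
  linarith

/-- The filtered function `h ↦ ∑ b_j V ((y + j) h)` of an even function behaves at `0⁺` like the
filtered fractional power of its expansion. -/
lemma sum_mul_comp_isLittleO {S : Finset ℤ} {b : ℤ → ℝ} {n Q : ℕ} (hnQ : n ≤ Q)
    (hb : ∀ q < Q, ∑ j ∈ S, b j * (j : ℝ) ^ q = 0) {V : ℝ → ℝ} (hV : ∀ h, V (-h) = V h)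
    {c : ℕ → ℝ} {κ p : ℝ} (hp : 0 < p) (hc : ∀ i, Odd i → c i = 0)
    (hc0 : V 0 = ∑ i ∈ Finset.range n, c i * 0 ^ i)
    (h : (fun x => V x - ∑ i ∈ Finset.range n, c i * x ^ i - κ * x ^ p)
      =o[nhdsWithin 0 (Set.Ioi 0)] (fun x : ℝ => x ^ p)) (y : ℝ) :
    (fun δ => ∑ j ∈ S, b j * V ((y + j) * δ) - κ * (∑ j ∈ S, b j * |y + j| ^ p) * δ ^ p)
      =o[nhdsWithin 0 (Set.Ioi 0)] (fun x : ℝ => x ^ p) := by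
  set ρ : ℝ → ℝ := fun x => V x - ∑ i ∈ Finset.range n, c i * x ^ i - κ * |x| ^ p with hρ
  have hρabs : ∀ x, ρ x = ρ |x| := by
    intro x
    rcases abs_choice x with hx | hx
    · rw [hx]
    · rw [hx, hρ]
      simp only [hV, abs_neg]
      congr 2
      refine Finset.sum_congr rfl fun i _ => ?_
      rcases Nat.even_or_odd i with hi | hi
      · rw [hi.neg_pow]
      · simp [hc i hi]
  have hρo : ρ =o[nhdsWithin 0 (Set.Ioi 0)] (fun x : ℝ => x ^ p) := by
    refine h.congr' ?_ EventuallyEq.rfl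
    filter_upwards [self_mem_nhdsWithin] with x hx
    rw [hρ]
    simp only [abs_of_pos (Set.mem_Ioi.1 hx)]
  have hρz : ∀ z : ℝ, (fun δ => ρ (z * δ)) =o[nhdsWithin 0 (Set.Ioi 0)] (fun x : ℝ => x ^ p) := by
    intro z
    rcases eq_or_ne z 0 with rfl | hz
    · have : ρ 0 = 0 := by simp [hρ, hc0, Real.zero_rpow hp.ne']
      simp [this]
    · have hz' : 0 < |z| := abs_pos.2 hz
      have ht : Tendsto (fun δ : ℝ => |z| * δ) (nhdsWithin 0 (Set.Ioi 0))
          (nhdsWithin 0 (Set.Ioi 0)) := by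
        refine tendsto_nhdsWithin_iff.2 ⟨?_, ?_⟩
        · have : ContinuousAt (fun δ : ℝ => |z| * δ) 0 := by fun_prop
          simpa using this.tendsto.mono_left (nhdsWithin_le_nhds (s := Set.Ioi 0))
        · filter_upwards [self_mem_nhdsWithin] with x hx
          exact mul_pos hz' hx
      have h1 := hρo.comp_tendsto ht
      have h2 : ((fun x : ℝ => x ^ p) ∘ fun δ => |z| * δ)
          =O[nhdsWithin 0 (Set.Ioi 0)] (fun x : ℝ => x ^ p) := by
        refine Asymptotics.IsBigO.of_bound (|z| ^ p) ?_
        filter_upwards [self_mem_nhdsWithin] with x hx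
        simp only [Function.comp]
        rw [Real.mul_rpow hz'.le (le_of_lt hx), norm_mul,
          Real.norm_of_nonneg (Real.rpow_nonneg hz'.le _)]
      refine (h1.trans_isBigO h2).congr' ?_ EventuallyEq.rfl
      filter_upwards [self_mem_nhdsWithin] with x hx
      simp only [Function.comp]
      rw [hρabs (z * x), abs_mul, abs_of_pos (Set.mem_Ioi.1 hx)]
  have hsum : (fun δ => ∑ j ∈ S, b j * ρ ((y + j) * δ))
      =o[nhdsWithin 0 (Set.Ioi 0)] (fun x : ℝ => x ^ p) :=
    Asymptotics.IsLittleO.fun_sum fun (j : ℤ) _ => (hρz (y + j)).const_mul_left (b j)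
  refine hsum.congr' ?_ EventuallyEq.rfl
  filter_upwards [self_mem_nhdsWithin] with δ hδ
  have hδ' : 0 < δ := hδ
  simp only [hρ, mul_sub, Finset.sum_sub_distrib]
  have hpoly : ∑ j ∈ S, b j * ∑ i ∈ Finset.range n, c i * ((y + j) * δ) ^ i = 0 := by
    simp_rw [Finset.mul_sum]
    rw [Finset.sum_comm]
    refine Finset.sum_eq_zero fun i hi => ?_
    have := sum_mul_affine_pow_eq_zero hb ((Finset.mem_range.1 hi).trans_le hnQ) (y * δ) δ
    rw [← mul_zero (c i), ← this, Finset.mul_sum]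
    refine Finset.sum_congr rfl fun j _ => ?_
    rw [show (y + j) * δ = y * δ + δ * j by ring]
    ring
  rw [hpoly, sub_zero, Finset.mul_sum, Finset.sum_mul]
  congr 1
  refine Finset.sum_congr rfl fun j _ => ?_
  rw [abs_mul, abs_of_pos hδ', Real.mul_rpow (abs_nonneg _) hδ'.le]
  ring

lemma abs_sum_mul_comp_le {N k Q : ℕ} {b : ℤ → ℝ} (hk : 1 ≤ k) (hkQ : k ≤ Q)
    (hb : ∀ q < Q, ∑ j ∈ Finset.Icc (-(N : ℤ)) N, b j * (j : ℝ) ^ q = 0) {V : ℝ → ℝ}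
    (hV : ContDiffOn ℝ k V (Set.Ioi 0)) {u δ B : ℝ} (hδ : 0 ≤ δ) (hu : 0 < u - N * δ)
    (hB : ∀ y ∈ Set.Icc (u - N * δ) (u + N * δ), |iteratedDeriv k V y| ≤ B) :
    |∑ j ∈ Finset.Icc (-(N : ℤ)) N, b j * V (u + j * δ)| ≤
      (∑ j ∈ Finset.Icc (-(N : ℤ)) N, |b j|) * (B * (2 * N * δ) ^ k) := by
  rcases eq_or_lt_of_le (by positivity : 0 ≤ N * δ) with h0 | h0
  · have hB0 : 0 ≤ B := (abs_nonneg _).trans (hB u ⟨by linarith, by linarith⟩)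
    have hz : ∑ j ∈ Finset.Icc (-(N : ℤ)) N, b j * V (u + j * δ) = 0 := by
      have hterm : ∀ j ∈ Finset.Icc (-(N : ℤ)) N, b j * V (u + j * δ) = V u * (b j * (j : ℝ) ^ 0) := by
        intro j hj
        have : (j : ℝ) * δ = 0 := by
          rcases mul_eq_zero.1 h0.symm with h | h
          · have : N = 0 := by exact_mod_cast h
            subst this
            have : j = 0 := by simpa using hj
            simp [this]
          · simp [h]
        rw [this]
        simp [mul_comm]
      rw [Finset.sum_congr rfl hterm, ← Finset.mul_sum, hb 0 (by omega), mul_zero]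
    rw [hz, abs_zero]
    positivity
  obtain ⟨n, rfl⟩ : ∃ n, k = n + 1 := ⟨k - 1, by omega⟩
  have hlt : u - N * δ < u + N * δ := by linarith
  set I := Set.Icc (u - N * δ) (u + N * δ) with hI
  have hsub : I ⊆ Set.Ioi 0 := fun y hy => lt_of_lt_of_le hu hy.1
  have hVI : ContDiffOn ℝ (n + 1) V I := by
    have := hV.mono hsub
    exact_mod_cast this
  have hbound : ∀ y ∈ I, ‖iteratedDerivWithin (n + 1) V I y‖ ≤ B := by
    intro y hy
    rw [iteratedDerivWithin_eq_iteratedDeriv (uniqueDiffOn_Icc hlt)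
      (hV.contDiffAt (Ioi_mem_nhds (hsub hy))) hy]
    exact hB y hy
  have hB0 : 0 ≤ B := (abs_nonneg _).trans (hB u ⟨by linarith, by linarith⟩)
  have hT : ∑ j ∈ Finset.Icc (-(N : ℤ)) N,
      b j * taylorWithinEval V n I (u - N * δ) (u + j * δ) = 0 := by
    simp_rw [taylor_within_apply, Finset.mul_sum]
    rw [Finset.sum_comm]
    refine Finset.sum_eq_zero fun i hi => ?_
    have := sum_mul_affine_pow_eq_zero hb ((Finset.mem_range.1 hi).trans_le hkQ) (N * δ) δ
    rw [← mul_zero (((i.factorial : ℝ)⁻¹) * iteratedDerivWithin i V I (u - N * δ)), ← this,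
      Finset.mul_sum]
    refine Finset.sum_congr rfl fun j _ => ?_
    rw [show u + j * δ - (u - N * δ) = N * δ + δ * j by ring, smul_eq_mul]
    ring
  rw [← sub_zero (∑ j ∈ Finset.Icc (-(N : ℤ)) N, b j * V (u + j * δ)), ← hT,
    ← Finset.sum_sub_distrib, Finset.sum_mul]
  refine (Finset.abs_sum_le_sum_abs _ _).trans (Finset.sum_le_sum fun j hj => ?_)
  rw [← mul_sub, abs_mul]
  refine mul_le_mul_of_nonneg_left ?_ (abs_nonneg _)
  rw [Finset.mem_Icc] at hj
  have hj1 : (-(N : ℝ)) ≤ j := by exact_mod_cast hj.1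
  have hj2 : (j : ℝ) ≤ N := by exact_mod_cast hj.2
  have hjδ1 := mul_le_mul_of_nonneg_right hj1 hδ
  have hjδ2 := mul_le_mul_of_nonneg_right hj2 hδ
  have hmem : u + j * δ ∈ I := ⟨by linarith, by linarith⟩
  refine (taylor_mean_remainder_bound hlt.le hVI hmem hbound).trans ?_
  refine (div_le_self (mul_nonneg hB0 (pow_nonneg (by linarith) _))
    (by exact_mod_cast n.factorial_pos)).trans ?_
  refine mul_le_mul_of_nonneg_left (pow_le_pow_left₀ (by linarith) (by linarith) _) hB0

lemma exists_abs_iteratedDeriv_le {V r : ℝ → ℝ} {n d : ℕ} {v c s β K : ℝ} (hd : 1 ≤ d)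
    (hExp : ∀ h : ℝ, iteratedDeriv n V h = v + c * |h| ^ s + r h)
    (hrd : ContDiffOn ℝ d r {(0 : ℝ)}ᶜ)
    (hr : ∀ h : ℝ, h ≠ 0 → |iteratedDeriv d r h| ≤ K * |h| ^ β) (hK : 0 < K) :
    ∃ K' : ℝ, 0 < K' ∧ ∀ h : ℝ, 0 < h →
      |iteratedDeriv (n + d) V h| ≤ K' * (h ^ (s - d) + h ^ β) := by
  refine ⟨|c * (descPochhammer ℝ d).eval s| + K, by positivity, fun h hh => ?_⟩
  have h1 : iteratedDeriv (n + d) V h = iteratedDeriv d (iteratedDeriv n V) h := by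
    simp only [iteratedDeriv_eq_iterate]
    rw [add_comm n d, Function.iterate_add_apply]
  have h2 : iteratedDeriv n V =ᶠ[nhds h] fun x => v + (c * x ^ s + r x) := by
    filter_upwards [Ioi_mem_nhds hh] with x hx
    rw [hExp, abs_of_pos (Set.mem_Ioi.1 hx), add_assoc]
  have hpow : ContDiffAt ℝ d (fun x : ℝ => x ^ s) h := Real.contDiffAt_rpow_const_of_ne hh.ne'
  rw [h1, h2.iteratedDeriv_eq, iteratedDeriv_const_add (by omega),
    iteratedDeriv_fun_add (contDiffAt_const.mul hpow)
      (hrd.contDiffAt (isOpen_compl_singleton.mem_nhds hh.ne')),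
    iteratedDeriv_const_mul_field, iteratedDeriv_eq_iterate (f := fun x : ℝ => x ^ s),
    Real.iter_deriv_rpow_const]
  have hr' := hr h hh.ne'
  rw [abs_of_pos hh] at hr'
  have p1 := Real.rpow_nonneg hh.le (s - d)
  have p2 := Real.rpow_nonneg hh.le β
  refine (abs_add_le _ _).trans ?_
  rw [← mul_assoc, abs_mul, abs_of_nonneg p1]
  have := abs_nonneg (c * (descPochhammer ℝ d).eval s)
  nlinarith [mul_nonneg this p2, mul_nonneg hK.le p1]

lemma exists_abs_sum_mul_comp_le_of_lt {N k Q : ℕ} {b : ℤ → ℝ} (hk : 1 ≤ k) (hkQ : k ≤ Q)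
    (hb : ∀ q < Q, ∑ j ∈ Finset.Icc (-(N : ℤ)) N, b j * (j : ℝ) ^ q = 0) {V : ℝ → ℝ}
    (hV : ContDiffOn ℝ k V (Set.Ioi 0)) {K γ β : ℝ} (hK : 0 < K) (hγβ : γ ≤ β) (hβ : β ≤ 0)
    (hbound : ∀ h : ℝ, 0 < h → |iteratedDeriv k V h| ≤ K * (h ^ γ + h ^ β)) :
    ∃ K' : ℝ, ∀ δ : ℝ, 0 < δ → δ ≤ 1 → ∀ m : ℕ, N < m →
      |∑ j ∈ Finset.Icc (-(N : ℤ)) N, b j * V ((m + j) * δ)| ≤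
        K' * (δ ^ (k + γ) * ((m : ℝ) + 1) ^ β) := by
  refine ⟨(∑ j ∈ Finset.Icc (-(N : ℤ)) N, |b j|) *
    (K * (((N : ℝ) + 2) ^ (-γ) + ((N : ℝ) + 2) ^ (-β)) * (2 * N) ^ k), fun δ hδ hδ1 m hm => ?_⟩
  have hm' : (N : ℝ) + 1 ≤ m := by exact_mod_cast hm
  have hN : (0 : ℝ) ≤ N := Nat.cast_nonneg N
  set x : ℝ := ((m : ℝ) + 1) * δ / (N + 2) with hx
  have hx0 : 0 < x := by positivity
  have hxle : x ≤ m * δ - N * δ := by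
    rw [hx, div_le_iff₀ (by positivity)]
    nlinarith [mul_nonneg (mul_nonneg (sub_nonneg.2 hm') hδ.le) (by positivity : 0 ≤ (N : ℝ) + 1)]
  have hmain := abs_sum_mul_comp_le hk hkQ hb hV (u := m * δ) (B := K * (x ^ γ + x ^ β)) hδ.le
    (hx0.trans_le hxle) (fun y hy => by
      have hxy : x ≤ y := hxle.trans hy.1
      refine (hbound y (hx0.trans_le hxy)).trans (mul_le_mul_of_nonneg_left ?_ hK.le)
      exact add_le_add (Real.rpow_le_rpow_of_nonpos hx0 hxy (hγβ.trans hβ))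
        (Real.rpow_le_rpow_of_nonpos hx0 hxy hβ))
  simp_rw [← add_mul] at hmain
  refine hmain.trans ?_
  have hxpow : ∀ e : ℝ, e ≤ β → γ ≤ e →
      x ^ e * δ ^ k ≤ ((N : ℝ) + 2) ^ (-e) * (δ ^ (k + γ) * ((m : ℝ) + 1) ^ β) := by
    intro e he1 he2
    rw [hx, Real.div_rpow (by positivity) (by positivity), Real.mul_rpow (by positivity) hδ.le,
      Real.rpow_neg (by positivity)]
    have e1 : δ ^ e * δ ^ k ≤ δ ^ (k + γ) := by
      rw [← Real.rpow_natCast δ k, ← Real.rpow_add hδ]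
      exact Real.rpow_le_rpow_of_exponent_ge hδ hδ1 (by linarith)
    have e2 : ((m : ℝ) + 1) ^ e ≤ ((m : ℝ) + 1) ^ β :=
      Real.rpow_le_rpow_of_exponent_le (by linarith [(Nat.cast_nonneg m : (0 : ℝ) ≤ m)]) he1
    have e3 := mul_le_mul e2 e1 (by positivity) (by positivity)
    calc ((m : ℝ) + 1) ^ e * δ ^ e / (N + 2) ^ e * δ ^ k
        = (((N : ℝ) + 2) ^ e)⁻¹ * (((m : ℝ) + 1) ^ e * (δ ^ e * δ ^ k)) := by ring
      _ ≤ (((N : ℝ) + 2) ^ e)⁻¹ * (((m : ℝ) + 1) ^ β * δ ^ (k + γ)) :=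
          mul_le_mul_of_nonneg_left e3 (by positivity)
      _ = _ := by ring
  have h1 := hxpow γ hγβ le_rfl
  have h2 := hxpow β le_rfl hγβ
  rw [mul_assoc (∑ j ∈ Finset.Icc (-(N : ℤ)) N, |b j|)]
  refine mul_le_mul_of_nonneg_left ?_ (Finset.sum_nonneg fun j _ => abs_nonneg (b j))
  calc K * (x ^ γ + x ^ β) * (2 * N * δ) ^ k
      = K * (2 * N) ^ k * (x ^ γ * δ ^ k + x ^ β * δ ^ k) := by rw [mul_pow]; ring
    _ ≤ K * (2 * N) ^ k * (((N : ℝ) + 2) ^ (-γ) * (δ ^ (k + γ) * ((m : ℝ) + 1) ^ β) +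
        ((N : ℝ) + 2) ^ (-β) * (δ ^ (k + γ) * ((m : ℝ) + 1) ^ β)) :=
        mul_le_mul_of_nonneg_left (add_le_add h1 h2) (by positivity)
    _ = _ := by ring

/-- Uniform bound on a filtered even function, near the origin and in the tail. -/
lemma exists_eventually_abs_sum_mul_comp_le {N k Q : ℕ} {b : ℤ → ℝ} (hk : 1 ≤ k) (hkQ : k ≤ Q)
    (hb : ∀ q < Q, ∑ j ∈ Finset.Icc (-(N : ℤ)) N, b j * (j : ℝ) ^ q = 0)
    (hbneg : ∀ j, b (-j) = b j) {V : ℝ → ℝ} (hVe : ∀ h, V (-h) = V h)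
    (hV : ContDiffOn ℝ k V (Set.Ioi 0)) {K γ β κ : ℝ} (hK : 0 < K) (hγβ : γ ≤ β) (hβ : β ≤ 0)
    (hbound : ∀ h : ℝ, 0 < h → |iteratedDeriv k V h| ≤ K * (h ^ γ + h ^ β)) {ψ : ℝ → ℝ}
    (hlim : ∀ y : ℝ, (fun δ => ∑ j ∈ Finset.Icc (-(N : ℤ)) N, b j * V ((y + j) * δ)
      - κ * ψ y * δ ^ (k + γ)) =o[nhdsWithin 0 (Set.Ioi 0)] (fun x : ℝ => x ^ (k + γ))) :
    ∃ K' : ℝ, 0 < K' ∧ ∀ᶠ δ in nhdsWithin (0 : ℝ) (Set.Ioi 0), ∀ m : ℤ,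
      |∑ j ∈ Finset.Icc (-(N : ℤ)) N, b j * V ((m + j) * δ)| ≤
        K' * δ ^ (k + γ) * ((m.natAbs : ℝ) + 1) ^ β := by
  obtain ⟨K₁, hK₁⟩ := exists_abs_sum_mul_comp_le_of_lt hk hkQ hb hV hK hγβ hβ hbound
  set F : ℕ → ℝ := fun m => (|κ * ψ m| + 1) * ((m : ℝ) + 1) ^ (-β) with hF
  have hF0 : ∀ m, 0 ≤ F m := fun m => by positivity
  set K' : ℝ := |K₁| + 1 + ∑ m ∈ Finset.range (N + 1), F m with hK'
  have hK'0 : 0 < K' := by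
    have := Finset.sum_nonneg fun m (_ : m ∈ Finset.range (N + 1)) => hF0 m
    positivity
  refine ⟨K', hK'0, ?_⟩
  have hsmall : ∀ᶠ δ in nhdsWithin (0 : ℝ) (Set.Ioi 0), ∀ m ∈ Finset.range (N + 1),
      |∑ j ∈ Finset.Icc (-(N : ℤ)) N, b j * V (((m : ℝ) + j) * δ) - κ * ψ m * δ ^ (k + γ)|
        ≤ δ ^ (k + γ) := by
    rw [Filter.eventually_all_finset]
    intro m _
    filter_upwards [Asymptotics.isLittleO_iff.1 (hlim m) one_pos, self_mem_nhdsWithin] with δ h1 h2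
    rwa [one_mul, Real.norm_of_nonneg (Real.rpow_nonneg (le_of_lt h2) _)] at h1
  have hle1 : ∀ᶠ δ in nhdsWithin (0 : ℝ) (Set.Ioi 0), δ ≤ 1 :=
    nhdsWithin_le_nhds (Iic_mem_nhds one_pos)
  filter_upwards [hsmall, hle1, self_mem_nhdsWithin] with δ hδs hδ1 hδ
  have hδ0 : 0 < δ := hδ
  have hδp : 0 < δ ^ (k + γ) := Real.rpow_pos_of_pos hδ0 _
  have hnat : ∀ m : ℕ, |∑ j ∈ Finset.Icc (-(N : ℤ)) N, b j * V (((m : ℝ) + j) * δ)| ≤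
      K' * δ ^ (k + γ) * ((m : ℝ) + 1) ^ β := by
    intro m
    have hmp : 0 < ((m : ℝ) + 1) ^ β := by positivity
    have hsum0 := Finset.sum_nonneg fun m (_ : m ∈ Finset.range (N + 1)) => hF0 m
    rcases lt_or_ge N m with h | h
    · refine (hK₁ δ hδ0 hδ1 m h).trans ?_
      rw [← mul_assoc]
      gcongr
      linarith [le_abs_self K₁]
    · have hm : m ∈ Finset.range (N + 1) := by simpa [Nat.lt_succ_iff] using h
      have h1 := hδs m hm
      have h2 : F m ≤ K' := by
        have := Finset.single_le_sum (fun m _ => hF0 m) hm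
        linarith [abs_nonneg K₁]
      have h3 : |∑ j ∈ Finset.Icc (-(N : ℤ)) N, b j * V (((m : ℝ) + j) * δ)| ≤
          (|κ * ψ m| + 1) * δ ^ (k + γ) := by
        have := abs_sub_abs_le_abs_sub (∑ j ∈ Finset.Icc (-(N : ℤ)) N, b j * V (((m : ℝ) + j) * δ))
          (κ * ψ m * δ ^ (k + γ))
        rw [abs_mul (κ * ψ m), abs_of_pos hδp] at this
        linarith
      have h4 : (|κ * ψ m| + 1) = F m * ((m : ℝ) + 1) ^ β := by
        rw [hF]
        simp only
        rw [mul_assoc, ← Real.rpow_add (by positivity)]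
        simp
      refine h3.trans ?_
      rw [h4]
      calc F m * ((m : ℝ) + 1) ^ β * δ ^ (k + γ) = F m * δ ^ (k + γ) * ((m : ℝ) + 1) ^ β := by ring
        _ ≤ _ := by gcongr
  intro m
  rcases Int.natAbs_eq m with h | h
  · have := hnat m.natAbs
    rw [h]
    simpa using this
  · have hrefl : ∑ j ∈ Finset.Icc (-(N : ℤ)) N, b j * V ((m + j) * δ) =
        ∑ j ∈ Finset.Icc (-(N : ℤ)) N, b j * V (((m.natAbs : ℝ) + j) * δ) := by
      refine Finset.sum_nbij' (fun j => -j) (fun j => -j) ?_ ?_ ?_ ?_ ?_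
      · intro j hj
        rw [Finset.mem_Icc] at hj ⊢
        omega
      · intro j hj
        rw [Finset.mem_Icc] at hj ⊢
        omega
      · simp
      · simp
      · intro j _
        have hm : (m : ℝ) = -(m.natAbs : ℝ) := by exact_mod_cast h
        rw [hbneg, ← hVe, hm]
        push_cast
        ring_nf
    rw [hrefl]
    exact hnat _

lemma sum_range_rpow_isLittleO {β : ℝ} (hβ : β < -(1 / 2)) :
    (fun n : ℕ => ∑ m ∈ Finset.range n, ((m : ℝ) + 1) ^ β) =o[atTop] fun n : ℕ => √(n : ℝ) := by
  have hg0 : (0 : ℕ → ℝ) ≤ fun m : ℕ => √((m + 1 : ℕ) : ℝ) - √(m : ℝ) := by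
    intro m
    simp only [Pi.zero_apply, sub_nonneg]
    exact Real.sqrt_le_sqrt (by simp)
  have htel : ∀ n : ℕ, ∑ m ∈ Finset.range n, (√((m + 1 : ℕ) : ℝ) - √(m : ℝ)) = √(n : ℝ) := by
    intro n
    rw [Finset.sum_range_sub (fun m : ℕ => √(m : ℝ))]
    simp
  have hcast : Tendsto (fun n : ℕ => (n : ℝ) + 1) atTop atTop :=
    tendsto_atTop_add_const_right _ _ tendsto_natCast_atTop_atTop
  have h1 : (fun m : ℕ => ((m : ℝ) + 1) ^ β) =o[atTop] fun m : ℕ => ((m : ℝ) + 1) ^ (-(1 / 2) : ℝ) := by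
    refine Asymptotics.isLittleO_of_tendsto (fun m h => ?_) ?_
    · have : ((m : ℝ) + 1) ^ (-(1 / 2) : ℝ) ≠ 0 := by positivity
      exact absurd h this
    · refine ((tendsto_rpow_neg_atTop (y := -(1 / 2) - β) (by linarith)).comp hcast).congr fun m => ?_
      rw [← Real.rpow_sub (by positivity)]
      simp only [Function.comp]
      congr 1
      ring
  have h2 : (fun m : ℕ => ((m : ℝ) + 1) ^ (-(1 / 2) : ℝ)) =O[atTop]
      fun m : ℕ => √((m + 1 : ℕ) : ℝ) - √(m : ℝ) := by
    refine Asymptotics.IsBigO.of_bound 2 (Eventually.of_forall fun m => ?_)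
    have hpos : 0 < √((m : ℝ) + 1) := Real.sqrt_pos.2 (by positivity)
    rw [Real.norm_of_nonneg (by positivity), Real.norm_of_nonneg (hg0 m), Real.rpow_neg (by positivity),
      ← Real.sqrt_eq_rpow, inv_le_iff_one_le_mul₀ hpos]
    push_cast
    have e1 := Real.sq_sqrt (by positivity : (0 : ℝ) ≤ (m : ℝ) + 1)
    have e2 := Real.sq_sqrt (by positivity : (0 : ℝ) ≤ (m : ℝ))
    nlinarith [sq_nonneg (√((m : ℝ) + 1) - √(m : ℝ))]
  have h3 := (h1.trans_isBigO h2).sum_range hg0 (by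
    simp_rw [htel]
    exact Real.tendsto_sqrt_atTop.comp tendsto_natCast_atTop_atTop)
  simpa only [htel] using h3

lemma sum_range_natAbs_sub_le {g : ℕ → ℝ} (hg : ∀ m, 0 ≤ g m) {n i : ℕ} (hi : i < n) :
    ∑ i' ∈ Finset.range n, g ((i : ℤ) - i').natAbs ≤ 2 * ∑ m ∈ Finset.range n, g m := by
  rw [two_mul, ← Finset.sum_filter_add_sum_filter_not _ (fun i' => i' ≤ i)]
  refine add_le_add ?_ ?_
  · rw [← Finset.sum_image (g := fun i' : ℕ => ((i : ℤ) - i').natAbs)]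
    · refine Finset.sum_le_sum_of_subset_of_nonneg ?_ fun _ _ _ => hg _
      intro x hx
      simp only [Finset.mem_image, Finset.mem_filter, Finset.mem_range] at hx ⊢
      omega
    · intro x hx y hy h
      simp only [Finset.coe_filter, Finset.mem_range, Set.mem_ofPred_eq] at hx hy h
      omega
  · rw [← Finset.sum_image (g := fun i' : ℕ => ((i : ℤ) - i').natAbs)]
    · refine Finset.sum_le_sum_of_subset_of_nonneg ?_ fun _ _ _ => hg _
      intro x hx
      simp only [Finset.mem_image, Finset.mem_filter, Finset.mem_range] at hx ⊢
      omega
    · intro x hx y hy h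
      simp only [Finset.coe_filter, Finset.mem_range, Set.mem_ofPred_eq] at hx hy h
      omega

lemma mul_le_sum_sum_sub {f : ℤ → ℝ} (hf : ∀ m, 0 ≤ f m) (n m : ℕ) :
    ((n : ℝ) - m) * f m ≤ ∑ i : Fin n, ∑ i' : Fin n, f ((i : ℤ) - i') := by
  rcases lt_or_ge n m with h | h
  · refine le_trans ?_ (Finset.sum_nonneg fun i _ => Finset.sum_nonneg fun i' _ => hf _)
    have : (n : ℝ) < m := by exact_mod_cast h
    exact mul_nonpos_of_nonpos_of_nonneg (by linarith) (hf _)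
  rw [Finset.sum_comm, Fin.sum_univ_eq_sum_range
    (fun i' => ∑ i : Fin n, f ((i : ℤ) - i')) n]
  calc ((n : ℝ) - m) * f m = ∑ _i' ∈ Finset.range (n - m), f m := by
        rw [Finset.sum_const, Finset.card_range, nsmul_eq_mul, Nat.cast_sub h]
    _ ≤ ∑ i' ∈ Finset.range (n - m), ∑ i : Fin n, f ((i : ℤ) - i') := by
        refine Finset.sum_le_sum fun i' hi' => ?_
        rw [Finset.mem_range] at hi'
        have := Finset.single_le_sum (f := fun i : Fin n => f ((i : ℤ) - i')) (fun i _ => hf _)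
          (Finset.mem_univ (⟨i' + m, by omega⟩ : Fin n))
        simpa using this
    _ ≤ _ := Finset.sum_le_sum_of_subset_of_nonneg
        (Finset.range_subset_range.2 (Nat.sub_le _ _))
        fun _ _ _ => Finset.sum_nonneg fun _ _ => hf _

/-- A Toeplitz array dominated entrywise by `w_n (|m| + 1) ^ β`, `β < -1/2`, with one diagonal of
exact order `w_n`, has row sums negligible with respect to its Hilbert--Schmidt norm. -/
lemma iSup_sum_abs_isLittleO {c : ℕ → ℤ → ℝ} {w : ℕ → ℝ} {K β η : ℝ} {m₀ L : ℕ}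
    (hw : ∀ᶠ n in atTop, 0 < w n) (hK : 0 < K) (hβ : β < -(1 / 2)) (hη : 0 < η)
    (hup : ∀ᶠ n in atTop, ∀ m : ℤ, |c n m| ≤ K * w n * ((m.natAbs : ℝ) + 1) ^ β)
    (hlow : ∀ᶠ n in atTop, η * w n ≤ |c n m₀|) :
    (fun n : ℕ => ⨆ i : Fin (n - L + 1), ∑ i' : Fin (n - L + 1), |c n ((i : ℤ) - i')|)
      =o[atTop] fun n : ℕ => √(2 * ∑ i : Fin (n - L + 1), ∑ i' : Fin (n - L + 1),
          c n ((i : ℤ) - i') ^ 2) := by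
  have hT : Tendsto (fun n : ℕ => n - L + 1) atTop atTop :=
    tendsto_atTop_mono (fun n => by omega) (tendsto_sub_atTop_nat L)
  have hsum := (sum_range_rpow_isLittleO hβ).comp_tendsto hT
  have hO : (fun n : ℕ => ⨆ i : Fin (n - L + 1), ∑ i' : Fin (n - L + 1), |c n ((i : ℤ) - i')|)
      =O[atTop] fun n : ℕ => w n * ∑ m ∈ Finset.range (n - L + 1), ((m : ℝ) + 1) ^ β := by
    refine Asymptotics.IsBigO.of_bound (2 * K) ?_
    filter_upwards [hw, hup] with n hwn hn
    have hs0 : 0 ≤ ∑ m ∈ Finset.range (n - L + 1), ((m : ℝ) + 1) ^ β :=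
      Finset.sum_nonneg fun m _ => by positivity
    rw [Real.norm_of_nonneg (Real.iSup_nonneg fun i => Finset.sum_nonneg fun _ _ => abs_nonneg _),
      Real.norm_of_nonneg (mul_nonneg hwn.le hs0)]
    refine ciSup_le fun i => ?_
    calc ∑ i' : Fin (n - L + 1), |c n ((i : ℤ) - i')|
        ≤ ∑ i' : Fin (n - L + 1), K * w n * ((((i : ℤ) - i').natAbs : ℝ) + 1) ^ β :=
          Finset.sum_le_sum fun i' _ => hn _
      _ = K * w n * ∑ i' ∈ Finset.range (n - L + 1),
            ((((i : ℕ) : ℤ) - i').natAbs + 1 : ℝ) ^ β := by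
          rw [← Finset.mul_sum, Fin.sum_univ_eq_sum_range
            (fun i' : ℕ => ((((i : ℕ) : ℤ) - i').natAbs + 1 : ℝ) ^ β)]
      _ ≤ K * w n * (2 * ∑ m ∈ Finset.range (n - L + 1), ((m : ℝ) + 1) ^ β) := by
          refine mul_le_mul_of_nonneg_left ?_ (by positivity)
          exact sum_range_natAbs_sub_le (g := fun m => ((m : ℝ) + 1) ^ β)
            (fun m => by positivity) i.2
      _ = _ := by ring
  have hΩ : (fun n : ℕ => w n * √((n - L + 1 : ℕ) : ℝ)) =O[atTop] fun n : ℕ =>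
      √(2 * ∑ i : Fin (n - L + 1), ∑ i' : Fin (n - L + 1), c n ((i : ℤ) - i') ^ 2) := by
    refine Asymptotics.IsBigO.of_bound η⁻¹ ?_
    filter_upwards [hw, hlow, hT.eventually_ge_atTop (2 * m₀)] with n hwn hn hm
    rw [Real.norm_of_nonneg (by positivity), Real.norm_of_nonneg (Real.sqrt_nonneg _),
      le_inv_mul_iff₀ hη, ← mul_assoc]
    refine Real.le_sqrt_of_sq_le ?_
    rw [mul_pow, Real.sq_sqrt (by positivity)]
    have h1 := mul_le_sum_sum_sub (f := fun m => c n m ^ 2) (fun m => sq_nonneg _) (n - L + 1) m₀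
    have h2 : (η * w n) ^ 2 ≤ c n m₀ ^ 2 := by
      rw [← sq_abs (c n m₀)]
      exact pow_le_pow_left₀ (by positivity) hn 2
    have h3 : (2 : ℝ) * m₀ ≤ (n - L + 1 : ℕ) := by exact_mod_cast hm
    have h4 : (η * w n) ^ 2 * ((n - L + 1 : ℕ) : ℝ) ≤ c n m₀ ^ 2 * (n - L + 1 : ℕ) :=
      mul_le_mul_of_nonneg_right h2 (Nat.cast_nonneg _)
    have h5 := mul_le_mul_of_nonneg_left h3 (sq_nonneg (c n m₀))
    linarith
  refine hO.trans_isLittleO (Asymptotics.IsLittleO.trans_isBigO ?_ hΩ)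
  exact (Asymptotics.isBigO_refl w atTop).mul_isLittleO hsum

/-- under (H0)–(H2), `δ_n = n^{−α}`, and a variation sequence `a` of length
`L` and order `M > D + s + 1/4`, the maximal absolute row sum of `Σ_n` is
`o(√(2 Σ_{i,i'} Σ_n(i,i')²)) = o(Var(V_{a,n})^{1/2})` as `n → ∞`. -/
theorem stmt_15 (V r : ℝ → ℝ) (D : ℕ) (C s α : ℝ)
    (hC : 0 < C) (hs0 : 0 < s) (hs2 : s < 2) (hα0 : 0 < α) (hα1 : α ≤ 1)
    -- (H0)
    (hEven : ∀ h : ℝ, V (-h) = V h) (hSmooth : ContDiffOn ℝ (⊤ : ℕ∞) V (Set.Ioi 0))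
    -- (H1)
    (hV2D : ContDiff ℝ ((2 * D : ℕ) : ℕ∞) V)
    (hExp : ∀ h : ℝ, iteratedDeriv (2 * D) V h
      = iteratedDeriv (2 * D) V 0 + C * (-1 : ℝ) ^ D * |h| ^ s + r h)
    (hro : r =o[nhds (0:ℝ)] fun h => |h| ^ s)
    -- (H2), with d = 2 if s < 3/2 and d = 3 otherwise
    (hrd : ContDiffOn ℝ ((if s < 3/2 then 2 else 3 : ℕ) : ℕ∞) r {(0:ℝ)}ᶜ)
    (hH2 : ∃ β K : ℝ, s - (if s < 3/2 then 2 else 3 : ℕ) < β ∧ β < -(1/2) ∧ 0 < K ∧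
      (∀ h : ℝ, h ≠ 0 → |iteratedDeriv (if s < 3/2 then 2 else 3 : ℕ) r h| ≤ K * |h| ^ β) ∧
      (∀ h : ℝ, 1 < |h| → |r h| ≤ K * |h| ^ s))
    -- variation sequence of length L and order M > D + s + 1/4
    (a : ℤ → ℝ) (L M : ℕ) (hL : 1 ≤ L) (hM : 1 ≤ M)
    (hsupp : ∀ j : ℤ, a j ≠ 0 → 0 ≤ j ∧ j ≤ (L : ℤ) - 1)
    (ha0 : a 0 ≠ 0) (haL : a ((L : ℤ) - 1) ≠ 0)
    (hmom : ∀ k : ℕ, k < M → ∑ᶠ j : ℤ, a j * (j : ℝ) ^ k = 0)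
    (hmomM : ∑ᶠ j : ℤ, a j * (j : ℝ) ^ M ≠ 0)
    (hMD : (D : ℝ) + s + 1 / 4 < M) :
    (fun n : ℕ => ⨆ i : Fin (n - L + 1), ∑ i' : Fin (n - L + 1), |covEnt a V α L n i i'|)
      =o[atTop] fun n : ℕ =>
        Real.sqrt (2 * ∑ i : Fin (n - L + 1), ∑ i' : Fin (n - L + 1),
          (covEnt a V α L n i i') ^ 2) := by
  obtain ⟨N, rfl⟩ : ∃ N, L = N + 1 := ⟨L - 1, by omega⟩
  have hsupp' : ∀ j : ℤ, a j ≠ 0 → 0 ≤ j ∧ j ≤ N := fun j hj => by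
    have := hsupp j hj
    push_cast at this
    omega
  have haN : a N ≠ 0 := by simpa using haL
  have hd1 : 1 ≤ (if s < 3/2 then 2 else 3 : ℕ) := by split_ifs <;> norm_num
  have hdM : 2 * D + (if s < 3/2 then 2 else 3 : ℕ) ≤ 2 * M := by
    split_ifs with h
    · have : D < M := by
        have : (D : ℝ) < M := by linarith
        exact_mod_cast this
      omega
    · have : D + 1 < M := by
        have : (D : ℝ) + 1 < M := by linarith
        exact_mod_cast this
      omega
  generalize (if s < 3/2 then 2 else 3 : ℕ) = d at hrd hH2 hd1 hdM
  obtain ⟨β, K, hsβ, hβ, hK, hr, -⟩ := hH2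
  set b : ℤ → ℝ := seqConv a a with hb
  have hmom2 : ∀ q < 2 * M, ∑ j ∈ Finset.Icc (-(N : ℤ)) N, b j * (j : ℝ) ^ q = 0 :=
    fun q hq => sum_seqConv_mul_pow hsupp' hmom hq
  have hbN : b (-N) ≠ 0 := by
    rw [hb, seqConv_neg_endpoint hsupp']
    exact mul_ne_zero ha0 haN
  set p : ℝ := ((2 * D + d : ℕ) : ℝ) + (s - d) with hp
  have hps : s + ((2 * D : ℕ) : ℝ) = p := by rw [hp]; push_cast; ring
  have hp0 : 0 < p := by rw [← hps]; positivity
  have hpM : p < (2 * M : ℕ) := by rw [← hps]; push_cast; linarith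
  have hpe : ∀ k : ℕ, Even k → p ≠ k := by
    rintro k ⟨l, rfl⟩ h
    rw [← hps] at h
    push_cast at h
    have h1 : (D : ℝ) < l := by linarith
    have h2 : (l : ℝ) < D + 1 := by linarith
    have h1' : D < l := by exact_mod_cast h1
    have h2' : l < D + 1 := by exact_mod_cast h2
    omega
  obtain ⟨m₀, hm₀⟩ := exists_sum_abs_rpow_ne_zero hmom2 hbN hpM hp0 hpe
  set ψ : ℝ → ℝ := fun y => ∑ j ∈ Finset.Icc (-(N : ℤ)) N, b j * |y + j| ^ p with hψ
  have hr0 : r 0 = 0 := by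
    have := hExp 0
    rw [abs_zero, Real.zero_rpow hs0.ne'] at this
    linarith
  obtain ⟨κ, hκ, hTaylor⟩ := exists_isLittleO_taylor_rpow hs0 (2 * D) V (C * (-1) ^ D)
    (by exact_mod_cast hV2D) (mul_ne_zero hC.ne' (pow_ne_zero _ (by norm_num))) (by
      refine (hro.mono nhdsWithin_le_nhds).congr' ?_ ?_
      · filter_upwards [self_mem_nhdsWithin] with x hx
        rw [hExp x, abs_of_pos (Set.mem_Ioi.1 hx)]
        ring
      · filter_upwards [self_mem_nhdsWithin] with x hx
        rw [abs_of_pos (Set.mem_Ioi.1 hx)])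
  rw [hps] at hTaylor
  have hlim : ∀ y : ℝ, (fun δ => ∑ j ∈ Finset.Icc (-(N : ℤ)) N, b j * V ((y + j) * δ)
      - κ * ψ y * δ ^ p) =o[nhdsWithin 0 (Set.Ioi 0)] (fun x : ℝ => x ^ p) :=
    sum_mul_comp_isLittleO (by omega) hmom2 hEven hp0
      (fun i hi => by rw [iteratedDeriv_zero_of_even_of_odd hEven hi, zero_div])
      (by simp [Finset.sum_range_succ']) hTaylor
  obtain ⟨K₁, hK₁, hbound⟩ := exists_abs_iteratedDeriv_le hd1 hExp (by exact_mod_cast hrd) hr hK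
  have hVk : ContDiffOn ℝ ((2 * D + d : ℕ) : WithTop ℕ∞) V (Set.Ioi 0) :=
    contDiffOn_infty.1 hSmooth _
  obtain ⟨K₂, hK₂, hup⟩ := exists_eventually_abs_sum_mul_comp_le (by omega) hdM hmom2
    (seqConv_neg a) hEven hVk hK₁ hsβ.le (by linarith) hbound hlim
  have hδ : Tendsto (fun n : ℕ => (n : ℝ) ^ (-α)) atTop (nhdsWithin 0 (Set.Ioi 0)) := by
    refine tendsto_nhdsWithin_iff.2
      ⟨(tendsto_rpow_neg_atTop hα0).comp tendsto_natCast_atTop_atTop, ?_⟩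
    filter_upwards [eventually_gt_atTop 0] with n hn
    exact Real.rpow_pos_of_pos (by exact_mod_cast hn) _
  let c : ℕ → ℤ → ℝ := fun n m => -∑ j ∈ Finset.Icc (-(N : ℤ)) N,
    b j * V ((m + j) * (n : ℝ) ^ (-α))
  have hcov : ∀ n (i i' : Fin (n - (N + 1) + 1)),
      covEnt a V α (N + 1) n i i' = c n ((i : ℤ) - i') := by
    intro n i i'
    unfold covEnt
    simp only [c]
    rw [finsum_eq_sum_of_support_subset (s := Finset.Icc (-(N : ℤ)) N) _ fun j hj =>
      Finset.mem_coe.2 (seqConv_ne_zero hsupp' (left_ne_zero_of_mul hj))]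
    push_cast
    rfl
  simp_rw [hcov]
  have hη : 0 < |κ * ψ m₀| / 2 := half_pos (abs_pos.2 (mul_ne_zero hκ hm₀))
  refine iSup_sum_abs_isLittleO (c := c) (L := N + 1) (w := fun n : ℕ => ((n : ℝ) ^ (-α)) ^ p) (m₀ := m₀)
    ?_ hK₂ hβ hη ?_ ?_
  · filter_upwards [tendsto_nhdsWithin_iff.1 hδ |>.2] with n hn
    exact Real.rpow_pos_of_pos hn _
  · filter_upwards [hδ.eventually hup] with n hn m
    simp only [c, abs_neg]
    exact hn m
  · filter_upwards [hδ.eventually (Asymptotics.isLittleO_iff.1 (hlim m₀) hη),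
      tendsto_nhdsWithin_iff.1 hδ |>.2] with n hn hn0
    have hpos : 0 < ((n : ℝ) ^ (-α)) ^ p := Real.rpow_pos_of_pos hn0 _
    rw [Real.norm_of_nonneg hpos.le, Real.norm_eq_abs, abs_sub_comm] at hn
    have h1 := abs_sub_abs_le_abs_sub (κ * ψ m₀ * ((n : ℝ) ^ (-α)) ^ p)
      (∑ j ∈ Finset.Icc (-(N : ℤ)) N, b j * V (((m₀ : ℝ) + j) * (n : ℝ) ^ (-α)))
    rw [abs_mul (κ * ψ m₀), abs_of_pos hpos] at h1
    simp only [c, abs_neg, Int.cast_natCast]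
    linarith
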